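/- arXiv:1904.00656 — 3 statements merged into one kernel-verified Lean document; each statement's English description precedes it below -/
import Mathlib

section
/- Let L be a relational first-order language and let 𝕏 be a countably infinite ultrahomogeneous L-structure with universe X. If a subset A ⊆ X intersects every orbit of 𝕏 (that is, orb_F(x) ∩ A ≠ ∅ for every finite F ⊆ X and every x ∈ X∖F), then A is a copy of 𝕏. -/
open FirstOrder FirstOrder.Language Set

universe u w

/-- For a relational language, any subset of a structure carries an induced substructure. -/
def inducedSub (L : Language.{u}) [L.IsRelational] {M : Type w} [L.Structure M]
    (A : Set M) : L.Substructure M where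
  carrier := A
  fun_mem := fun {_} f => isEmptyElim f

/-- `A` is a copy of `M`: the induced substructure on `A` is isomorphic to `M`. -/
def IsCopy (L : Language.{u}) [L.IsRelational] {M : Type w} [L.Structure M]
    (A : Set M) : Prop :=
  Nonempty ((inducedSub L A) ≃[L] M)

/-- The orbit of `x` under automorphisms of `M` fixing `F` pointwise. -/
def orb (L : Language.{u}) {M : Type w} [L.Structure M] (F : Set M) (x : M) : Set M :=
  {y | ∃ g : M ≃[L] M, (∀ a ∈ F, g a = a) ∧ g x = y}

theorem orbit_hitting_set_is_copy (L : Language.{u}) [L.IsRelational]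
    (M : Type w) [L.Structure M] [Countable M] [Infinite M]
    (hM : L.IsUltrahomogeneous M) (A : Set M)
    (hA : ∀ F : Set M, F.Finite → ∀ x ∈ (Set.univ : Set M) \ F,
      (orb L F x ∩ A).Nonempty) :
    IsCopy L A := by
  have extAM : L.IsExtensionPair (inducedSub L A) M := by
    rw [isExtensionPair_iff_exists_embedding_closure_singleton_sup]
    intro S hS f m
    haveI : Nonempty ((Substructure.closure L {m} ⊔ S : L.Substructure (inducedSub L A)) ↪[L] M) :=
      ⟨(inducedSub L A).subtype.comp (Substructure.subtype _)⟩
    exact hM.extend_embedding ((Substructure.fg_iff_structure_fg S).1 hS) f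
      (Substructure.inclusion le_sup_right)
  have extMA : L.IsExtensionPair M (inducedSub L A) := by
    rw [isExtensionPair_iff_exists_embedding_closure_singleton_sup]
    intro S hS f m
    obtain ⟨g, hg⟩ := hM S hS ((inducedSub L A).subtype.comp f)
    have hg' : ∀ s : S, g (s : M) = (f s : M) := fun s => (DFunLike.congr_fun hg s).symm
    have key : ∃ k : M ≃[L] M, (∀ s : S, k (s : M) = (f s : M)) ∧ k m ∈ A := by
      by_cases hm : m ∈ S
      · refine ⟨g, hg', ?_⟩
        have := hg' ⟨m, hm⟩
        simp only at this
        rw [this]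
        exact (f ⟨m, hm⟩).2
      · haveI : Finite S := hS.finite
        have hfin : (g '' (S : Set M)).Finite := Set.Finite.image _ (Set.toFinite (S : Set M))
        obtain ⟨y, ⟨h, hfix, hy⟩, hyA⟩ := hA _ hfin (g m) ⟨trivial, by
          rintro ⟨x, hx, hxm⟩
          exact hm (g.injective hxm ▸ hx)⟩
        refine ⟨h.comp g, fun s => ?_, ?_⟩
        · rw [Equiv.comp_apply, hfix _ ⟨s, s.2, rfl⟩, hg']
        · rw [Equiv.comp_apply, hy]
          exact hyA
    obtain ⟨k, hk, hkm⟩ := key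
    have hmem : ∀ c : (Substructure.closure L {m} ⊔ S : L.Substructure M),
        (k.toEmbedding.comp (Substructure.subtype _)) c ∈ inducedSub L A := by
      intro c
      have hle : Substructure.closure L {m} ⊔ S ≤
          (inducedSub L A).comap k.toEmbedding.toHom := by
        refine sup_le ?_ ?_
        · rw [Substructure.closure_le, Set.singleton_subset_iff]
          exact hkm
        · intro s hs
          change k s ∈ A
          have := hk ⟨s, hs⟩
          simp only at this
          rw [this]
          exact (f ⟨s, hs⟩).2
      exact hle c.2
    refine ⟨(k.toEmbedding.comp (Substructure.subtype _)).codRestrict _ hmem, ?_⟩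
    ext s
    exact (hk s).symm
  haveI : Countable (inducedSub L A) := Subtype.countable
  let f₀ : (⊥ : L.Substructure (inducedSub L A)) ↪[L] M :=
    (inducedSub L A).subtype.comp (Substructure.subtype _)
  obtain ⟨e, -⟩ := equiv_between_cg Structure.cg_of_countable Structure.cg_of_countable
    ⟨⟨⊥, _, f₀.equivRange⟩, Substructure.fg_bot⟩ extAM extMA
  exact ⟨e⟩
end

section
/- Let L be a relational first-order language and let 𝕏 be a countably infinite ultrahomogeneous L-structure with universe X whose age has the strong amalgamation property. Then X can be partitioned into countably many pairwise disjoint large copies of 𝕏: there is a family {B_j : j ∈ ℕ} of pairwise disjoint large copies of 𝕏 with ⋃_{j∈ℕ} B_j = X. -/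
open FirstOrder FirstOrder.Language Set CategoryTheory

universe u w

/-- A copy is large if it meets every orbit in an infinite set. -/
def IsLargeCopy (L : Language.{u}) [L.IsRelational] {M : Type w} [L.Structure M]
    (A : Set M) : Prop :=
  IsCopy L A ∧ ∀ F : Set M, F.Finite → ∀ x ∈ (Set.univ : Set M) \ F,
    (A ∩ orb L F x).Infinite

/-- The age of `M` (as a class of bundled structures): finite structures embeddable in `M`. -/
def InAge (L : Language.{u}) (M : Type w) [L.Structure M]
    (N : Bundled.{w} L.Structure) : Prop :=
  Finite N ∧ Nonempty (N ↪[L] M)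

/-- The age of `M` has the strong amalgamation property. -/
def AgeHasSAP (L : Language.{u}) (M : Type w) [L.Structure M] : Prop :=
  ∀ A B C : Bundled.{w} L.Structure, InAge L M A → InAge L M B → InAge L M C →
    ∀ (f₀ : A ↪[L] B) (g₀ : A ↪[L] C),
      ∃ D : Bundled.{w} L.Structure, InAge L M D ∧
        ∃ (f₁ : B ↪[L] D) (g₁ : C ↪[L] D),
          f₁.comp f₀ = g₁.comp g₀ ∧
          Set.range f₁ ∩ Set.range g₁ = Set.range (f₁.comp f₀)

open Classical in
/-- An injective choice function from a sequence of infinite sets. -/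
noncomputable def pickSeq {M : Type w} (O : ℕ → Set M) (h : ∀ n, (O n).Infinite) : ℕ → M
  | n => Classical.choose ((h n).exists_notMem_finset
      (Finset.univ.image fun i : Fin n => pickSeq O h i))
decreasing_by all_goals exact i.2

theorem pickSeq_spec {M : Type w} (O : ℕ → Set M) (h : ∀ n, (O n).Infinite) (n : ℕ) :
    pickSeq O h n ∈ O n ∧ ∀ i < n, pickSeq O h i ≠ pickSeq O h n := by
  classical
  have := Classical.choose_spec ((h n).exists_notMem_finset
      (Finset.univ.image fun i : Fin n => pickSeq O h i))
  rw [pickSeq]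
  refine ⟨this.1, fun i hi he => this.2 ?_⟩
  rw [Finset.mem_image]
  exact ⟨⟨i, hi⟩, Finset.mem_univ _, by convert he⟩

theorem exists_inj_choice {M : Type w} {ι : Type*} [Countable ι] (O : ι → Set M)
    (h : ∀ n, (O n).Infinite) : ∃ y : ι → M, Function.Injective y ∧ ∀ i, y i ∈ O i := by
  rcases isEmpty_or_nonempty ι with hι | hι
  · exact ⟨fun i => isEmptyElim i, fun i => isEmptyElim i, fun i => isEmptyElim i⟩
  obtain ⟨e, he⟩ := exists_injective_nat ι
  let O' : ℕ → Set M := fun n => O (Function.invFun e n)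
  have h' : ∀ n, (O' n).Infinite := fun n => h _
  refine ⟨fun i => pickSeq O' h' (e i), ?_, fun i => ?_⟩
  · intro i j hij
    by_contra hne
    rcases lt_or_gt_of_ne (fun hh => hne (he hh)) with hl | hl
    · exact (pickSeq_spec O' h' _).2 _ hl hij
    · exact (pickSeq_spec O' h' _).2 _ hl hij.symm
  · have := (pickSeq_spec O' h' (e i)).1
    simpa [O', Function.leftInverse_invFun he i] using this

theorem exists_coloring {M : Type w} {κ : Type*} [Countable κ] (O : κ → Set M)
    (h : ∀ n, (O n).Infinite) : ∃ c : M → ℕ, ∀ k j, (c ⁻¹' {j} ∩ O k).Infinite := by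
  obtain ⟨y, hy, hyO⟩ := exists_inj_choice (ι := κ × ℕ × ℕ) (fun p => O p.1) (fun p => h p.1)
  refine ⟨Function.extend y (fun p => p.2.1) 0, fun k j => ?_⟩
  refine Set.infinite_of_injective_forall_mem (f := fun n : ℕ => y (k, j, n)) ?_ ?_
  · intro a b hab
    simpa using hy hab
  · intro n
    refine ⟨?_, hyO (k, j, n)⟩
    simp [hy.extend_apply]

theorem orb_infinite (L : Language.{u}) [L.IsRelational]
    (M : Type w) [L.Structure M]
    (hM : L.IsUltrahomogeneous M) (hSAP : AgeHasSAP L M) (F : Set M) (hF : F.Finite)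
    (x : M) (hx : x ∉ F) : (orb L F x).Infinite := by
  intro hfin
  let A := inducedSub L F
  let B := inducedSub L (F ∪ orb L F x)
  let C := inducedSub L (insert x F)
  have hAB : A ≤ B := fun a ha => Or.inl ha
  have hAC : A ≤ C := fun a ha => Or.inr ha
  have fA : Finite A := hF
  have fB : Finite B := hF.union hfin
  have fC : Finite C := hF.insert x
  obtain ⟨D, ⟨_, ⟨d⟩⟩, f₁, g₁, hcomp, hrange⟩ :=
    hSAP ⟨A, inferInstance⟩ ⟨B, inferInstance⟩ ⟨C, inferInstance⟩
      ⟨fA, ⟨A.subtype⟩⟩ ⟨fB, ⟨B.subtype⟩⟩ ⟨fC, ⟨C.subtype⟩⟩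
      (Substructure.inclusion hAB) (Substructure.inclusion hAC)
  obtain ⟨g, hg⟩ := hM B Substructure.FG.of_finite (d.comp f₁)
  have hg' : ∀ b : B, d (f₁ b) = g b := fun b => DFunLike.congr_fun hg b
  let e : C ↪[L] M := g.symm.toEmbedding.comp (d.comp g₁)
  obtain ⟨k, hk⟩ := hM C Substructure.FG.of_finite e
  have hk' : ∀ c : C, g.symm (d (g₁ c)) = k c := fun c => DFunLike.congr_fun hk c
  have hc : ∀ a : A, f₁ (Substructure.inclusion hAB a) = g₁ (Substructure.inclusion hAC a) :=
    fun a => DFunLike.congr_fun hcomp a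
  have hkF : ∀ a ∈ F, k a = a := by
    intro a ha
    have h1 := hk' (Substructure.inclusion hAC ⟨a, ha⟩)
    rw [← hc, hg'] at h1
    simpa using h1.symm
  have hkx : k x ∈ orb L F x := ⟨k, hkF, rfl⟩
  let xc : C := ⟨x, Or.inl rfl⟩
  let yb : B := ⟨k x, Or.inr hkx⟩
  have heq : f₁ yb = g₁ xc := by
    apply d.injective
    rw [hg']
    have := hk' xc
    change g (k x) = _
    change _ = k x at this
    rw [← this]; simp
  have hmem : g₁ xc ∈ Set.range f₁ ∩ Set.range g₁ := ⟨⟨yb, heq⟩, ⟨xc, rfl⟩⟩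
  rw [hrange] at hmem
  obtain ⟨a, ha⟩ := hmem
  have h2 : g₁ (Substructure.inclusion hAC a) = g₁ xc := by
    rw [← hc]; exact ha
  have h3 := congrArg Subtype.val (g₁.injective h2)
  apply hx
  have h4 : (a : A).1 = x := h3
  rw [← h4]
  exact a.2

theorem isCopy_of_meets (L : Language.{u}) [L.IsRelational]
    (M : Type w) [L.Structure M] [Countable M]
    (hM : L.IsUltrahomogeneous M) (B : Set M)
    (hB : ∀ F : Set M, F.Finite → ∀ x ∉ F, (B ∩ orb L F x).Nonempty) : IsCopy L B := by
  let N := inducedSub L B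
  have ext1 : L.IsExtensionPair N M := by
    rw [isExtensionPair_iff_exists_embedding_closure_singleton_sup]
    intro S hS f m
    have : Nonempty ((Substructure.closure L {m} ⊔ S : L.Substructure N) ↪[L] M) :=
      ⟨N.subtype.comp (Substructure.subtype _)⟩
    exact hM.extend_embedding ((Substructure.fg_iff_structure_fg S).1 hS) f _
  have ext2 : L.IsExtensionPair M N := by
    rw [isExtensionPair_iff_exists_embedding_closure_singleton_sup]
    intro S hS f m
    have fS : Finite S := hS.finite
    obtain ⟨g, hg⟩ := hM S hS (N.subtype.comp f)
    have hg' : ∀ s : S, (f s : M) = g s := fun s => DFunLike.congr_fun hg s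
    have key : ∃ k : M ≃[L] M, (∀ s : S, (f s : M) = k s) ∧ k m ∈ B := by
      by_cases hm : m ∈ S
      · exact ⟨g, hg', by rw [← hg' ⟨m, hm⟩]; exact (f _).2⟩
      · obtain ⟨y, hy, h, hh, rfl⟩ := hB (g '' (S : Set M)) (Set.Finite.image _ fS) (g m) (by
          rintro ⟨s, hs, hsm⟩
          exact hm (g.injective hsm ▸ hs))
        refine ⟨h.comp g, fun s => ?_, hy⟩
        rw [hg']
        exact (hh _ ⟨s, s.2, rfl⟩).symm
    obtain ⟨k, hk, hkm⟩ := key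
    have hle : Substructure.closure L {m} ⊔ S ≤ N.comap k.toHom := by
      refine sup_le ?_ ?_
      · rw [Substructure.closure_le]
        rintro _ rfl
        exact hkm
      · intro s hs
        change k s ∈ N
        rw [← hk ⟨s, hs⟩]
        exact (f _).2
    refine ⟨Embedding.codRestrict N (k.toEmbedding.comp (Substructure.subtype _))
      (fun c => hle c.2), ?_⟩
    ext s
    exact hk s
  have : Countable N := inferInstanceAs (Countable B)
  obtain ⟨f, -⟩ := equiv_between_cg (Structure.cg_of_countable (L := L) (M := N))
    (Structure.cg_of_countable (L := L) (M := M))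
    ⟨⟨⊥, _, (N.subtype.comp (⊥ : L.Substructure N).subtype).equivRange⟩, Substructure.fg_bot⟩
    ext1 ext2
  exact ⟨f⟩

theorem partition_into_large_copies (L : Language.{u}) [L.IsRelational]
    (M : Type w) [L.Structure M] [Countable M] [Infinite M]
    (hM : L.IsUltrahomogeneous M) (hSAP : AgeHasSAP L M) :
    ∃ B : ℕ → Set M, (∀ j, IsLargeCopy L (B j)) ∧
      (∀ i j, i ≠ j → Disjoint (B i) (B j)) ∧
      (⋃ j, B j) = Set.univ := by
  obtain ⟨c, hc⟩ := exists_coloring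
    (κ := {p : Finset M × M // p.2 ∉ (p.1 : Set M)}) (fun p => orb L (p.1.1 : Set M) p.1.2)
    (fun p => orb_infinite L M hM hSAP _ p.1.1.finite_toSet _ p.2)
  have hc' : ∀ j, ∀ F : Set M, F.Finite → ∀ x ∉ F, (c ⁻¹' {j} ∩ orb L F x).Infinite := by
    intro j F hF x hx
    simpa using hc ⟨(hF.toFinset, x), by simpa using hx⟩ j
  refine ⟨fun j => c ⁻¹' {j}, fun j => ⟨?_, fun F hF x hx => hc' j F hF x hx.2⟩, ?_, ?_⟩
  · exact isCopy_of_meets L M hM _ fun F hF x hx => (hc' j F hF x hx).nonempty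
  · intro i j hij
    exact Disjoint.preimage _ (by simpa using hij)
  · ext m
    simp
end

section
/- Let L be a relational first-order language and let 𝕏 be a countably infinite ultrahomogeneous L-structure with universe X whose age has the strong amalgamation property. Then the partial order ⟨ℙ(𝕏), ⊆⟩ of copies of 𝕏 contains an antichain of cardinality 2^ℵ₀, and moreover a maximal antichain of cardinality 2^ℵ₀. -/
open FirstOrder FirstOrder.Language Set CategoryTheory

universe u w

/-- Two copies are compatible if some copy is contained in both. -/
def Compat (L : Language.{u}) [L.IsRelational] {M : Type w} [L.Structure M]
    (A B : Set M) : Prop :=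
  ∃ C : Set M, IsCopy L C ∧ C ⊆ A ∧ C ⊆ B

/-- An antichain in the poset of copies of `M`. -/
def IsCopyAntichain (L : Language.{u}) [L.IsRelational] {M : Type w} [L.Structure M]
    (𝒜 : Set (Set M)) : Prop :=
  (∀ A ∈ 𝒜, IsCopy L A) ∧ ∀ A ∈ 𝒜, ∀ B ∈ 𝒜, A ≠ B → ¬ Compat L A B

/-- A maximal antichain in the poset of copies of `M`. -/
def IsMaxCopyAntichain (L : Language.{u}) [L.IsRelational] {M : Type w} [L.Structure M]
    (𝒜 : Set (Set M)) : Prop :=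
  IsCopyAntichain L 𝒜 ∧ ∀ Z : Set M, IsCopy L Z → ∃ A ∈ 𝒜, Compat L Z A

/-- Points outside a finite set can be moved off any finite set, fixing the former. -/
theorem aux_move (L : Language.{u}) [L.IsRelational] {M : Type w} [L.Structure M]
    (hM : L.IsUltrahomogeneous M) (hSAP : AgeHasSAP L M)
    (F S : Set M) (hF : F.Finite) (hS : S.Finite) (x : M) (hx : x ∉ F) :
    ∃ h : M ≃[L] M, (∀ a ∈ F, h a = a) ∧ h x ∉ S := by
  let A := inducedSub L F
  let B := inducedSub L (insert x F)
  let C := inducedSub L (F ∪ S)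
  have hAB : A ≤ B := fun a ha => Set.mem_insert_of_mem x ha
  have hAC : A ≤ C := fun a ha => Set.mem_union_left S ha
  have fA : Finite A := hF
  have fB : Finite B := hF.insert x
  have fC : Finite C := hF.union hS
  obtain ⟨D, ⟨_, ⟨e⟩⟩, f₁, g₁, hc, hr⟩ := hSAP (Bundled.of A) (Bundled.of B) (Bundled.of C)
    ⟨fA, ⟨A.subtype⟩⟩ ⟨fB, ⟨B.subtype⟩⟩ ⟨fC, ⟨C.subtype⟩⟩
    (Substructure.inclusion hAB) (Substructure.inclusion hAC)
  obtain ⟨a, ha⟩ := hM C Substructure.FG.of_finite (e.comp g₁)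
  obtain ⟨b, hb⟩ := hM B Substructure.FG.of_finite (e.comp f₁)
  have ha' : ∀ c : C, e (g₁ c) = a c := fun c => DFunLike.congr_fun ha c
  have hb' : ∀ c : B, e (f₁ c) = b c := fun c => DFunLike.congr_fun hb c
  have hc' : ∀ c : A, f₁ (Substructure.inclusion hAB c) = g₁ (Substructure.inclusion hAC c) :=
    fun c => DFunLike.congr_fun hc c
  refine ⟨a.symm.comp b, ?_, ?_⟩
  · intro y hy
    have h1 := hb' (Substructure.inclusion hAB ⟨y, hy⟩)
    have h2 := ha' (Substructure.inclusion hAC ⟨y, hy⟩)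
    rw [hc' ⟨y, hy⟩, h2] at h1
    have h3 : a y = b y := h1
    rw [Equiv.comp_apply, ← h3]
    exact a.toEquiv.symm_apply_apply y
  · intro hmem
    have h1 : a (a.symm (b x)) = b x := a.toEquiv.apply_symm_apply (b x)
    rw [Equiv.comp_apply] at hmem
    have h2 := ha' ⟨a.symm (b x), Or.inr hmem⟩
    have h3 := hb' ⟨x, Set.mem_insert x F⟩
    have h4 : f₁ ⟨x, Set.mem_insert x F⟩ = g₁ ⟨a.symm (b x), Or.inr hmem⟩ :=
      e.injective (h3.trans (h1.symm.trans h2.symm))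
    have h5 : f₁ ⟨x, Set.mem_insert x F⟩ ∈ Set.range f₁ ∩ Set.range g₁ :=
      ⟨⟨_, rfl⟩, ⟨_, h4.symm⟩⟩
    rw [hr] at h5
    obtain ⟨y, hy⟩ := h5
    have h6 := f₁.injective hy
    have h7 : ((show A from y : A) : M) = x := congrArg (fun z : B => (z : M)) h6
    exact hx (h7 ▸ (show A from y).2)

theorem aux_ext (L : Language.{u}) [L.IsRelational] {M : Type w} [L.Structure M]
    (hM : L.IsUltrahomogeneous M) (hSAP : AgeHasSAP L M) (m : ℕ ≃ M)
    (g : M ≃[L] M) (n : ℕ) (S : Set M) (hS : S.Finite) :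
    ∃ g' : M ≃[L] M, (∀ i < n, g' (m i) = g (m i)) ∧ g' (m n) ∉ S := by
  obtain ⟨h, h1, h2⟩ := aux_move L hM hSAP ((fun i => g (m i)) '' Set.Iio n) S
    ((Set.finite_Iio n).image _) hS (g (m n)) (by
      rintro ⟨i, hi, h⟩
      have := m.injective (g.injective h)
      simp at hi
      omega)
  exact ⟨h.comp g, fun i hi => h1 _ ⟨i, hi, rfl⟩, h2⟩

/-- depth in the binary heap -/
def auxDepth : ℕ → ℕ
  | 0 => 0
  | k + 1 => auxDepth (k / 2) + 1
  decreasing_by omega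

def auxPath (f : ℕ → Bool) : ℕ → ℕ
  | 0 => 0
  | n + 1 => 2 * auxPath f n + (f n).toNat + 1

theorem auxPath_half (f : ℕ → Bool) (n : ℕ) :
    (2 * auxPath f n + (f n).toNat) / 2 = auxPath f n := by
  have := (f n).toNat_lt
  omega

theorem auxDepth_path (f : ℕ → Bool) (n : ℕ) : auxDepth (auxPath f n) = n := by
  induction n with
  | zero => simp [auxPath, auxDepth]
  | succ n ih => rw [auxPath, auxDepth, auxPath_half, ih]

theorem auxPath_inj (f g : ℕ → Bool) (n : ℕ) (h : auxPath f n = auxPath g n) :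
    ∀ i < n, f i = g i := by
  induction n with
  | zero => intro i hi; omega
  | succ n ih =>
    rw [auxPath, auxPath] at h
    have h1 := (f n).toNat_lt
    have h2 := (g n).toNat_lt
    intro i hi
    rcases Nat.lt_succ_iff_lt_or_eq.1 hi with hi | rfl
    · exact ih (by omega) i hi
    · have h3 : (f i).toNat = (g i).toNat := by omega
      revert h3
      cases f i <;> cases g i <;> simp

theorem aux_tree (L : Language.{u}) [L.IsRelational] {M : Type w} [L.Structure M]
    (hM : L.IsUltrahomogeneous M) (hSAP : AgeHasSAP L M) (m : ℕ ≃ M) :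
    ∃ g : ℕ → (M ≃[L] M),
      (∀ k, ∀ i < auxDepth (k + 1), g (k + 1) (m i) = g (k / 2) (m i)) ∧
      Function.Injective (fun k => g k (m (auxDepth k))) := by
  choose E hE1 hE2 using aux_ext L hM hSAP m
  let G : (k : ℕ) → ((j : ℕ) → j < k → (M ≃[L] M)) → (M ≃[L] M) := fun k r =>
    match k, r with
    | 0, _ => FirstOrder.Language.Equiv.refl L M
    | k + 1, r => E (r (k / 2) (by omega)) (auxDepth (k + 1))
        (Set.range (fun j : Fin (k + 1) => r j j.2 (m (auxDepth j)))) (Set.finite_range _)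
  let g : ℕ → (M ≃[L] M) := (Nat.lt_wfRel.wf).fix G
  have hg : ∀ k, g (k + 1) = E (g (k / 2)) (auxDepth (k + 1))
        (Set.range (fun j : Fin (k + 1) => g j (m (auxDepth j)))) (Set.finite_range _) := by
    intro k
    exact (Nat.lt_wfRel.wf).fix_eq G (k + 1)
  have key : ∀ j k, j < k → g k (m (auxDepth k)) ≠ g j (m (auxDepth j)) := by
    intro j k hjk h
    obtain ⟨k, rfl⟩ : ∃ k', k = k' + 1 := ⟨k - 1, by omega⟩
    rw [hg k] at h
    exact hE2 (g (k / 2)) (auxDepth (k + 1))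
      (Set.range (fun j : Fin (k + 1) => g j (m (auxDepth j)))) (Set.finite_range _) ⟨(⟨j, hjk⟩ : Fin (k + 1)), h.symm⟩
  refine ⟨g, ?_, ?_⟩
  · intro k i hi
    rw [hg k]
    exact hE1 _ _ _ _ i hi
  · intro j k h
    rcases lt_trichotomy j k with h1 | h1 | h1
    · exact absurd h.symm (key _ _ h1)
    · exact h1
    · exact absurd h (key _ _ h1)

theorem aux_range_copy (L : Language.{u}) [L.IsRelational] {M : Type w} [L.Structure M]
    (e : M ↪[L] M) : IsCopy L (Set.range e) := by
  have : inducedSub L (Set.range e) = e.toHom.range := by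
    ext x
    rfl
  unfold IsCopy
  rw [this]
  exact ⟨e.equivRange.symm⟩

theorem aux_copy_infinite (L : Language.{u}) [L.IsRelational] {M : Type w} [L.Structure M]
    [Infinite M] (A : Set M) (h : IsCopy L A) : A.Infinite := by
  obtain ⟨e⟩ := h
  intro hf
  have : Finite (inducedSub L A) := hf
  have : Finite M := Finite.of_equiv _ e.toEquiv
  exact not_finite M

/-- An almost disjoint family of copies. -/
theorem aux_family (L : Language.{u}) [L.IsRelational] {M : Type w} [L.Structure M]
    [Countable M] [Infinite M]
    (hM : L.IsUltrahomogeneous M) (hSAP : AgeHasSAP L M) :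
    ∃ A : (ℕ → Bool) → Set M, (∀ f, IsCopy L (A f)) ∧ ∀ f f', f ≠ f' → (A f ∩ A f').Finite := by
  obtain ⟨m⟩ : Nonempty (ℕ ≃ M) := by
    obtain ⟨d⟩ := nonempty_denumerable M
    exact ⟨(Denumerable.eqv M).symm⟩
  obtain ⟨g, hg1, hg2⟩ := aux_tree L hM hSAP m
  have hstep : ∀ f n, ∀ i ≤ n, g (auxPath f (n + 1)) (m i) = g (auxPath f n) (m i) := by
    intro f n i hi
    have h := hg1 (2 * auxPath f n + (f n).toNat) i
    rw [auxPath_half] at h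
    apply h
    rw [auxDepth, auxPath_half, auxDepth_path]
    omega
  have hagree : ∀ f n, ∀ i ≤ n, g (auxPath f n) (m i) = g (auxPath f i) (m i) := by
    intro f n i hi
    induction n, hi using Nat.le_induction with
    | base => rfl
    | succ n hn ih => rw [hstep f n i hn, ih]
  let v : ℕ → M := fun k => g k (m (auxDepth k))
  have hv : ∀ f n, g (auxPath f n) (m n) = v (auxPath f n) := by
    intro f n
    simp only [v, auxDepth_path]
  let e : (ℕ → Bool) → M → M := fun f x => v (auxPath f (m.symm x))
  have he : ∀ f n x, m.symm x ≤ n → e f x = g (auxPath f n) x := by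
    intro f n x hx
    have := hagree f n _ hx
    rw [hv, m.apply_symm_apply] at this
    exact this.symm
  have hinj : ∀ f, Function.Injective (e f) := by
    intro f x y hxy
    rw [he f (max (m.symm x) (m.symm y)) x (le_max_left _ _),
      he f (max (m.symm x) (m.symm y)) y (le_max_right _ _)] at hxy
    exact (g _).injective hxy
  let E : (ℕ → Bool) → (M ↪[L] M) := fun f =>
    { toFun := e f
      inj' := hinj f
      map_fun' := fun {n} φ => isEmptyElim φ
      map_rel' := by
        intro n r x
        obtain ⟨N, hN⟩ : ∃ N, ∀ i, m.symm (x i) ≤ N :=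
          ⟨Finset.univ.sup (fun i => m.symm (x i)),
            fun i => Finset.le_sup (f := fun i => m.symm (x i)) (Finset.mem_univ i)⟩
        have : e f ∘ x = g (auxPath f N) ∘ x := by
          funext i
          exact he f N (x i) (hN i)
        rw [this]
        exact (g (auxPath f N)).map_rel r x }
  refine ⟨fun f => Set.range (E f), fun f => aux_range_copy L (E f), ?_⟩
  intro f f' hff
  obtain ⟨k, hk⟩ := Function.ne_iff.1 hff
  refine ((Set.finite_Iic k).image (fun n => v (auxPath f n))).subset ?_
  rintro _ ⟨⟨x, rfl⟩, ⟨y, hy⟩⟩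
  have hy' : auxPath f' (m.symm y) = auxPath f (m.symm x) := hg2 hy
  have hd : m.symm y = m.symm x := by
    have := congrArg auxDepth hy'
    rwa [auxDepth_path, auxDepth_path] at this
  rw [hd] at hy'
  refine ⟨m.symm x, ?_, rfl⟩
  by_contra hlt
  simp at hlt
  exact hk (auxPath_inj f f' _ hy'.symm k hlt)

theorem aux_maximal (L : Language.{u}) [L.IsRelational] {M : Type w} [L.Structure M]
    (𝒜 : Set (Set M)) (h : IsCopyAntichain L 𝒜) :
    ∃ ℬ : Set (Set M), 𝒜 ⊆ ℬ ∧ IsMaxCopyAntichain L ℬ := by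
  obtain ⟨ℬ, hsub, hmax⟩ := zorn_subset_nonempty {𝒞 : Set (Set M) | IsCopyAntichain L 𝒞} (by
    intro c hc hchain _
    refine ⟨⋃₀ c, ⟨?_, ?_⟩, fun s hs => Set.subset_sUnion_of_mem hs⟩
    · rintro A ⟨s, hs, hA⟩
      exact (hc hs).1 A hA
    · rintro A ⟨s, hs, hA⟩ B ⟨t, ht, hB⟩ hne
      rcases hchain.total hs ht with hst | hst
      · exact (hc ht).2 A (hst hA) B hB hne
      · exact (hc hs).2 A hA B (hst hB) hne) 𝒜 h
  have hℬ : IsCopyAntichain L ℬ := hmax.prop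
  refine ⟨ℬ, hsub, hℬ, ?_⟩
  intro Z hZ
  by_contra! hno
  have hins : IsCopyAntichain L (insert Z ℬ) := by
    refine ⟨?_, ?_⟩
    · rintro A (rfl | hA)
      · exact hZ
      · exact hℬ.1 A hA
    · rintro A (rfl | hA) B (rfl | hB) hne
      · exact absurd rfl hne
      · exact hno B hB
      · rintro ⟨C, h1, h2, h3⟩
        exact hno A hA ⟨C, h1, h3, h2⟩
      · exact hℬ.2 A hA B hB hne
  have hZmem : Z ∈ ℬ := hmax.le_of_ge hins (Set.subset_insert _ _) (Set.mem_insert _ _)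
  exact hno Z hZmem ⟨Z, hZ, subset_rfl, subset_rfl⟩


theorem antichains_of_size_continuum (L : Language.{u}) [L.IsRelational]
    (M : Type w) [L.Structure M] [Countable M] [Infinite M]
    (hM : L.IsUltrahomogeneous M) (hSAP : AgeHasSAP L M) :
    (∃ 𝒜 : Set (Set M), IsCopyAntichain L 𝒜 ∧ Cardinal.mk 𝒜 = Cardinal.continuum) ∧
    (∃ 𝒜 : Set (Set M), IsMaxCopyAntichain L 𝒜 ∧ Cardinal.mk 𝒜 = Cardinal.continuum) := by
  obtain ⟨A, hA1, hA2⟩ := aux_family L hM hSAP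
  have hinj : Function.Injective A := by
    intro f f' h
    by_contra hne
    have h1 := hA2 f f' hne
    rw [← h, Set.inter_self] at h1
    exact aux_copy_infinite L _ (hA1 f) h1
  have hanti : IsCopyAntichain L (Set.range A) := by
    refine ⟨?_, ?_⟩
    · rintro _ ⟨f, rfl⟩
      exact hA1 f
    · rintro _ ⟨f, rfl⟩ _ ⟨f', rfl⟩ hne ⟨C, hC, h1, h2⟩
      have hff : f ≠ f' := fun h => hne (congrArg A h)
      exact aux_copy_infinite L C hC ((hA2 f f' hff).subset (Set.subset_inter h1 h2))
  have hcard : Cardinal.mk (Set.range A) = Cardinal.continuum := by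
    have := Cardinal.mk_range_eq_of_injective hinj
    simpa using this
  refine ⟨⟨_, hanti, hcard⟩, ?_⟩
  obtain ⟨ℬ, hsub, hℬ⟩ := aux_maximal L _ hanti
  refine ⟨ℬ, hℬ, le_antisymm ?_ ?_⟩
  · refine (Cardinal.mk_set_le ℬ).trans ?_
    rw [Cardinal.mk_set, Cardinal.mk_eq_aleph0 M, Cardinal.two_power_aleph0]
  · rw [← hcard]
    exact Cardinal.mk_le_mk_of_subset hsub
end
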